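/- Let Σ_A be a one-sided countable topological Markov shift, φ : Σ_A → ℝ a measurable potential, and ν a σ-finite Borel measure with ν(π_n^{−1}{a}) < ∞ for every n ≥ 0 and a ∈ ℕ, where π_n(x) := x_n. If ν is non-singular and (φ,λ)-conformal for some λ > 0, then ν is a φ-DLR measure. -/

import Mathlib

open MeasureTheory Filter Topology ENNReal

namespace CMS

/-- A sequence is admissible for the transition matrix `A`. -/
def IsAdm (A : ℕ → ℕ → Bool) (u : ℕ → ℕ) : Prop := ∀ i, A (u i) (u (i + 1)) = true

/-- The one-sided countable topological Markov shift. -/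
abbrev Space (A : ℕ → ℕ → Bool) := {u : ℕ → ℕ // IsAdm A u}

/-- The transition matrix has no row and no column identically zero. -/
def NoDegenerate (A : ℕ → ℕ → Bool) : Prop :=
  (∀ i, ∃ j, A i j = true) ∧ (∀ j, ∃ i, A i j = true)

/-- The shift map. -/
def shift {A : ℕ → ℕ → Bool} (x : Space A) : Space A :=
  ⟨fun i => x.1 (i + 1), fun i => x.2 (i + 1)⟩

/-- Birkhoff (ergodic) sum `φ_n`. -/
noncomputable def birkhoff {A : ℕ → ℕ → Bool} (φ : Space A → ℝ) (n : ℕ) (x : Space A) : ℝ :=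
  ∑ i ∈ Finset.range n, φ (shift^[i] x)

/-- The cylinder set determined by a word. -/
def cyl (A : ℕ → ℕ → Bool) (w : List ℕ) : Set (Space A) :=
  {x | ∀ i : Fin w.length, x.1 i = w.get i}

/-- Concatenation of a finite word with a sequence. -/
def concatSeq (w : List ℕ) (u : ℕ → ℕ) : ℕ → ℕ :=
  fun i => if h : i < w.length then w.get ⟨i, h⟩ else u (i - w.length)

/-- Prepending a single symbol to a sequence. -/
def prependSeq (a : ℕ) (u : ℕ → ℕ) : ℕ → ℕ := fun i => Nat.casesOn i a u

/-- The set of points to which the symbol `a` may be prepended. -/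
def admits (A : ℕ → ℕ → Bool) (a : ℕ) : Set (Space A) := {x | A a (x.1 0) = true}

/-- Prepending a symbol to a point of the shift space (identity if not admissible). -/
noncomputable def prep (A : ℕ → ℕ → Bool) (a : ℕ) (x : Space A) : Space A :=
  if h : A a (x.1 0) = true then
    ⟨prependSeq a x.1, by
      intro i
      cases i with
      | zero => exact h
      | succ j => exact x.2 j⟩
  else x

/-- The measure `ν ⊚ σ`, `ν⊚σ(E) = Σ_a ν(σ(E ∩ [a]))`. -/
noncomputable def circ (A : ℕ → ℕ → Bool) (ν : Measure (Space A)) : Measure (Space A) :=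
  Measure.sum fun a : ℕ => (ν.restrict (admits A a)).map (prep A a)

/-- `ν` is `(φ, l)`-conformal: `dν/d(ν⊚σ) = l⁻¹ e^φ`. -/
def Conformal (A : ℕ → ℕ → Bool) (φ : Space A → ℝ) (l : ℝ) (ν : Measure (Space A)) : Prop :=
  ∀ E : Set (Space A), MeasurableSet E →
    ν E = ∫⁻ x in E, ENNReal.ofReal (l⁻¹ * Real.exp (φ x)) ∂(circ A ν)

/-- The Ruelle transfer operator. -/
noncomputable def ruelle (A : ℕ → ℕ → Bool) (φ f : Space A → ℝ) (x : Space A) : ℝ :=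
  ∑' a : ℕ, if A a (x.1 0) = true then Real.exp (φ (prep A a x)) * f (prep A a x) else 0

/-- The Ruelle operator applied to the constant function 1, valued in `ℝ≥0∞`. -/
noncomputable def ruelleOne (A : ℕ → ℕ → Bool) (φ : Space A → ℝ) (x : Space A) : ℝ≥0∞ :=
  ∑' a : ℕ, if A a (x.1 0) = true then ENNReal.ofReal (Real.exp (φ (prep A a x))) else 0

/-- `L*_φ ν = l ν` : the dual eigenmeasure equation. -/
def DualEigen (A : ℕ → ℕ → Bool) (φ : Space A → ℝ) (l : ℝ) (ν : Measure (Space A)) : Prop :=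
  ∀ f : Space A → ℝ, Integrable f ν →
    ∫ x, ruelle A φ f x ∂ν = l * ∫ x, f x ∂ν

/-- The sub-σ-algebra `σ^{-n} 𝓑`. -/
def shiftSigma (A : ℕ → ℕ → Bool) (n : ℕ) : MeasurableSpace (Space A) :=
  MeasurableSpace.comap (shift^[n]) inferInstance

/-- A sub-σ-algebra `m` is compatible with `ν`: the restriction of `ν` to `m` is σ-finite. -/
def Compatible (A : ℕ → ℕ → Bool) (ν : Measure (Space A))
    (m : MeasurableSpace (Space A)) : Prop :=
  ∃ s : ℕ → Set (Space A), (∀ k, MeasurableSet[m] (s k)) ∧ (∀ k, ν (s k) ≠ ⊤) ∧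
    (⋃ k, s k) = Set.univ

open Classical in
/-- Numerator of the DLR kernel: `e^{φ_n(w σ^n x)} 1{w σ^n x ∈ Σ_A}`. -/
noncomputable def dlrNum (A : ℕ → ℕ → Bool) (φ : Space A → ℝ) (w : List ℕ)
    (x : Space A) : ℝ :=
  if h : IsAdm A (concatSeq w ((shift^[w.length] x).1)) then
    Real.exp (birkhoff φ w.length (⟨concatSeq w ((shift^[w.length] x).1), h⟩ : Space A))
  else 0

/-- Denominator of the DLR kernel: `Σ_{y : σ^n y = σ^n x} e^{φ_n(y)}`. -/
noncomputable def dlrDen (A : ℕ → ℕ → Bool) (φ : Space A → ℝ) (n : ℕ) (x : Space A) : ℝ :=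
  ∑' y : {y : Space A // shift^[n] y = shift^[n] x}, Real.exp (birkhoff φ n y.1)

/-- `ν` is a `φ`-DLR measure. -/
def IsDLR (A : ℕ → ℕ → Bool) (φ : Space A → ℝ) (ν : Measure (Space A)) : Prop :=
  ∀ n : ℕ, 1 ≤ n →
    Compatible A ν (shiftSigma A n) ∧
    ∀ w : List ℕ, w.length = n →
      (ν[Set.indicator (cyl A w) (fun _ => (1 : ℝ))|shiftSigma A n])
        =ᵐ[ν] fun x => dlrNum A φ w x / dlrDen A φ n x

/-- `ν` is non-singular: `ν ∘ σ⁻¹ ∼ ν`. -/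
def NonSingular (A : ℕ → ℕ → Bool) (ν : Measure (Space A)) : Prop :=
  ν.map shift ≪ ν ∧ ν ≪ ν.map shift

/-- Conservative non-singular measure. -/
def Conservative (A : ℕ → ℕ → Bool) (ν : Measure (Space A)) : Prop :=
  NonSingular A ν ∧
    ∀ W : Set (Space A), MeasurableSet W →
      (∀ i j : ℕ, i ≠ j → ν ((shift^[i] ⁻¹' W) ∩ (shift^[j] ⁻¹' W)) = 0) → ν W = 0

/-- The `n`-th variation `Var_n φ`, valued in `ℝ≥0∞`. -/
noncomputable def varn (A : ℕ → ℕ → Bool) (φ : Space A → ℝ) (n : ℕ) : ℝ≥0∞ :=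
  ⨆ (x : Space A) (y : Space A) (_ : ∀ i, i < n → x.1 i = y.1 i),
    ENNReal.ofReal |φ x - φ y|

noncomputable def waltersBound (A : ℕ → ℕ → Bool) (φ : Space A → ℝ) (k : ℕ) : ℝ≥0∞ :=
  ⨆ (n : ℕ) (_ : 1 ≤ n), varn A (birkhoff φ n) (n + k)

/-- The Walters condition. -/
def Walters (A : ℕ → ℕ → Bool) (φ : Space A → ℝ) : Prop :=
  (∀ k, 1 ≤ k → waltersBound A φ k ≠ ⊤) ∧
  Tendsto (waltersBound A φ) atTop (nhds 0)

/-- `φ` is weakly Hölder continuous. -/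
def WeaklyHolder (A : ℕ → ℕ → Bool) (φ : Space A → ℝ) : Prop :=
  ∃ H θ : ℝ, 0 < H ∧ θ ∈ Set.Ioo (0 : ℝ) 1 ∧
    ∀ n : ℕ, 2 ≤ n → varn A φ n ≤ ENNReal.ofReal (H * θ ^ n)

/-- The partition function `Z_n(φ, a)`, valued in `ℝ≥0∞`. -/
noncomputable def Zn (A : ℕ → ℕ → Bool) (φ : Space A → ℝ) (n a : ℕ) : ℝ≥0∞ :=
  ∑' x : {x : Space A // shift^[n] x = x ∧ x.1 0 = a},
    ENNReal.ofReal (Real.exp (birkhoff φ n x.1))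

/-- The partition function `Z*_n(φ, a)` over periodic points whose first return to `[a]` is `n`. -/
noncomputable def Znstar (A : ℕ → ℕ → Bool) (φ : Space A → ℝ) (n a : ℕ) : ℝ≥0∞ :=
  ∑' x : {x : Space A // shift^[n] x = x ∧ x.1 0 = a ∧
      ∀ k, 0 < k → k < n → (shift^[k] x).1 0 ≠ a},
    ENNReal.ofReal (Real.exp (birkhoff φ n x.1))

/-- `P` is the (finite) Gurevich pressure of `φ`. -/
def HasGurevich (A : ℕ → ℕ → Bool) (φ : Space A → ℝ) (P : ℝ) : Prop :=
  ∀ a : ℕ, (cyl A [a]).Nonempty →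
    (∀ n, 1 ≤ n → Zn A φ n a ≠ ⊤) ∧
    Tendsto (fun n : ℕ => Real.log (Zn A φ n a).toReal / n) atTop (nhds P)

/-- `φ` is recurrent (with Gurevich pressure `P`). -/
def Recurrent (A : ℕ → ℕ → Bool) (φ : Space A → ℝ) (P : ℝ) : Prop :=
  ∀ a : ℕ, (cyl A [a]).Nonempty →
    ∑' n : ℕ, ENNReal.ofReal (Real.exp (-((n + 1 : ℕ) : ℝ) * P)) * Zn A φ (n + 1) a = ⊤

/-- `φ` is positive recurrent (with Gurevich pressure `P`). -/
def PosRecurrent (A : ℕ → ℕ → Bool) (φ : Space A → ℝ) (P : ℝ) : Prop :=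
  Recurrent A φ P ∧
  ∀ a : ℕ, (cyl A [a]).Nonempty →
    ∑' n : ℕ, ((n + 1 : ℕ) : ℝ≥0∞) *
      ENNReal.ofReal (Real.exp (-((n + 1 : ℕ) : ℝ) * P)) * Znstar A φ (n + 1) a ≠ ⊤

/-- `φ` is transient (with Gurevich pressure `P`). -/
def Transient (A : ℕ → ℕ → Bool) (φ : Space A → ℝ) (P : ℝ) : Prop :=
  ∀ a : ℕ, (cyl A [a]).Nonempty →
    ∑' n : ℕ, ENNReal.ofReal (Real.exp (-((n + 1 : ℕ) : ℝ) * P)) * Zn A φ (n + 1) a ≠ ⊤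

/-- `Σ_A` is topologically mixing. -/
def TopMixing (A : ℕ → ℕ → Bool) : Prop :=
  ∀ a b : ℕ, ∃ N : ℕ, ∀ n, N < n → ∃ x : Space A, x.1 0 = a ∧ (shift^[n] x).1 0 = b

/-- The big images and preimages (BIP) property. -/
def BIP (A : ℕ → ℕ → Bool) : Prop :=
  ∃ (N : ℕ) (b : Fin N → ℕ), ∀ a : ℕ,
    (∃ i, A (b i) a = true) ∧ (∃ j, A a (b j) = true)

/-- An admissible word. -/
def AdmWord (A : ℕ → ℕ → Bool) (w : List ℕ) : Prop :=
  ∀ (i : ℕ) (h : i + 1 < w.length),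
    A (w.get ⟨i, Nat.lt_of_succ_lt h⟩) (w.get ⟨i + 1, h⟩) = true

/-- The image of `E ⊆ [a̲]` under the cylinder-swapping map `v_{a̲,b̲}`. -/
def swapImage (A : ℕ → ℕ → Bool) (b : List ℕ) (E : Set (Space A)) : Set (Space A) :=
  {y | ∃ x ∈ E, y.1 = concatSeq b ((shift^[b.length] x).1)}

/-- The image of `E` under the prepending map `I_b`. -/
def prepImage (A : ℕ → ℕ → Bool) (b : ℕ) (E : Set (Space A)) : Set (Space A) :=
  {y | ∃ x ∈ E, y.1 = prependSeq b x.1}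

/-- The transition matrix of the renewal shift:
`A(1,1) = A(1,i) = A(i,i-1) = 1` (for `i > 1`), all other entries `0`. -/
def renA : ℕ → ℕ → Bool := fun i j => decide ((i = 1 ∧ 1 ≤ j) ∨ (2 ≤ i ∧ j = i - 1))

/-- The transition matrix of the shift `Σ_{𝓡⁻}`:
`A(i,i+1) = A(i,1) = 1` for `i ≥ 1`, all other entries `0`. -/
def rminusA : ℕ → ℕ → Bool := fun i j => decide (1 ≤ i ∧ (j = i + 1 ∨ j = 1))

/-- The periodic sequence obtained by repeating the word `w`. -/
def perSeq (w : List ℕ) : ℕ → ℕ := fun i => w.getD (i % w.length) 0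

/-- The word `(j, j-1, …, 1, n, n-1, …, j+1)`. -/
def gammaWord (j n : ℕ) : List ℕ :=
  ((List.range j).map (· + 1)).reverse ++ ((List.range (n - j)).map (· + (j + 1))).reverse

/-- The point `x̄ = (1, 2, 3, …)` of `Σ_{𝓡⁻}`. -/
def xbar : Space rminusA := ⟨fun i => i + 1, by intro i; simp [rminusA]⟩

section Fibers

variable {A : ℕ → ℕ → Bool}

lemma measurable_shift : Measurable (shift : Space A → Space A) := by
  refine Measurable.subtype_mk (measurable_pi_iff.2 fun i => ?_)
  exact (measurable_pi_apply (i + 1)).comp measurable_subtype_coe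

lemma measurable_coord (i : ℕ) : Measurable fun x : Space A => x.1 i :=
  (measurable_pi_apply i).comp measurable_subtype_coe

lemma measurableSet_admits (a : ℕ) : MeasurableSet (admits A a) :=
  measurable_coord 0 (MeasurableSet.of_discrete (s := {b : ℕ | A a b = true}))

lemma measurable_prep (a : ℕ) : Measurable (prep A a) := by
  have h : Measurable fun x : Space A => (prep A a x).1 := by
    refine measurable_pi_iff.2 fun i => ?_
    have h₁ : Measurable fun x : Space A => prependSeq a x.1 i := by
      cases i with
      | zero => exact measurable_const
      | succ j => exact measurable_coord j
    have h₂ : (fun x : Space A => (prep A a x).1 i)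
        = fun x => if A a (x.1 0) = true then prependSeq a x.1 i else x.1 i := by
      funext x
      by_cases hx : A a (x.1 0) = true <;> simp [prep, hx]
    rw [h₂]
    exact Measurable.ite (measurableSet_admits a) h₁ (measurable_coord i)
  exact h.subtype_mk

lemma measurableSet_cyl (w : List ℕ) : MeasurableSet (cyl A w) := by
  have : cyl A w = ⋂ i : Fin w.length, {x | x.1 i = w.get i} := by
    ext x; simp [cyl]
  rw [this]
  exact MeasurableSet.iInter fun i => measurable_coord (A := A) i (measurableSet_singleton (w.get i))

lemma shift_iterate_apply (n : ℕ) (x : Space A) (i : ℕ) : (shift^[n] x).1 i = x.1 (i + n) := by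
  induction n generalizing x with
  | zero => rfl
  | succ n ih =>
    rw [Function.iterate_succ_apply, ih]
    exact congrArg x.1 (by ring)

lemma prep_val {a : ℕ} {x : Space A} (h : x ∈ admits A a) :
    (prep A a x).1 = prependSeq a x.1 := by
  have h' : A a (x.1 0) = true := h
  simp [prep, h']

lemma shift_prep {a : ℕ} {x : Space A} (h : x ∈ admits A a) : shift (prep A a x) = x := by
  apply Subtype.ext
  funext i
  change (prep A a x).1 (i + 1) = _
  rw [prep_val h]
  rfl

lemma shift_mem_admits (y : Space A) : shift y ∈ admits A (y.1 0) := y.2 0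

lemma prep_shift (y : Space A) : prep A (y.1 0) (shift y) = y := by
  apply Subtype.ext
  rw [prep_val (shift_mem_admits y)]
  funext i
  cases i <;> rfl

/-- The preimages of `x` under the shift correspond to the symbols which may precede `x`. -/
noncomputable def admitsEquivFiber (x : Space A) :
    {a : ℕ // x ∈ admits A a} ≃ {y : Space A // shift y = x} where
  toFun a := ⟨prep A a x, shift_prep a.2⟩
  invFun y := ⟨y.1.1 0, by simpa only [y.2] using shift_mem_admits y.1⟩
  left_inv a := by
    apply Subtype.ext
    change (prep A a x).1 0 = a
    rw [prep_val a.2]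
    rfl
  right_inv := by
    rintro ⟨y, rfl⟩
    exact Subtype.ext (prep_shift y)

/-- The fibers of `shift^[n + 1]` are partitioned into fibers of `shift^[n]`. -/
def fiberSuccEquiv (n : ℕ) (x : Space A) :
    (Σ z : {z : Space A // shift z = x}, {y : Space A // shift^[n] y = z.1}) ≃
      {y : Space A // shift^[n + 1] y = x} where
  toFun p := ⟨p.2.1, by rw [Function.iterate_succ_apply', p.2.2, p.1.2]⟩
  invFun y := ⟨⟨shift^[n] y.1, by rw [← Function.iterate_succ_apply' shift, y.2]⟩, ⟨y.1, rfl⟩⟩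
  left_inv := by
    rintro ⟨⟨z, hz⟩, ⟨y, hy⟩⟩
    cases hy
    rfl
  right_inv _ := rfl

lemma eq_concatSeq_iff {w : List ℕ} {y z : Space A} :
    y.1 = concatSeq w z.1 ↔ shift^[w.length] y = z ∧ y ∈ cyl A w := by
  constructor
  · intro h
    refine ⟨Subtype.ext (funext fun i => ?_), fun i => ?_⟩
    · rw [shift_iterate_apply, h]
      simp [concatSeq]
    · rw [h]
      simp [concatSeq]
  · rintro ⟨rfl, hy⟩
    funext i
    by_cases hi : i < w.length
    · simpa [concatSeq, hi] using hy ⟨i, hi⟩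
    · simp only [concatSeq, hi, dite_false, shift_iterate_apply]
      rw [Nat.sub_add_cancel (not_lt.1 hi)]

end Fibers

section Transfer

variable {A : ℕ → ℕ → Bool} {φ : Space A → ℝ} {l : ℝ} {ν : Measure (Space A)}

/-- The Ruelle transfer operator on functions with values in `ℝ≥0∞`. -/
noncomputable def transfer (φ : Space A → ℝ) (f : Space A → ℝ≥0∞) (x : Space A) : ℝ≥0∞ :=
  ∑' a : ℕ, (admits A a).indicator
    (fun z => ENNReal.ofReal (Real.exp (φ (prep A a z))) * f (prep A a z)) x

lemma transfer_eq_tsum_fiber (f : Space A → ℝ≥0∞) (x : Space A) :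
    transfer φ f x =
      ∑' y : {y : Space A // shift y = x}, ENNReal.ofReal (Real.exp (φ y)) * f y := by
  rw [← (admitsEquivFiber x).tsum_eq]
  exact (tsum_subtype {a : ℕ | x ∈ admits A a}
    fun a => ENNReal.ofReal (Real.exp (φ (prep A a x))) * f (prep A a x)).symm

lemma transfer_iterate_eq_tsum_fiber (n : ℕ) (f : Space A → ℝ≥0∞) (x : Space A) :
    (transfer φ)^[n] f x = ∑' y : {y : Space A // shift^[n] y = x},
      ENNReal.ofReal (Real.exp (birkhoff φ n y)) * f y := by
  induction n generalizing x with
  | zero =>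
    rw [tsum_eq_single (⟨x, rfl⟩ : {y : Space A // shift^[0] y = x})
      fun y hy => (hy (Subtype.ext y.2)).elim]
    simp [birkhoff]
  | succ n ih =>
    rw [Function.iterate_succ_apply', transfer_eq_tsum_fiber,
      ← (fiberSuccEquiv n x).tsum_eq, ENNReal.tsum_sigma']
    refine tsum_congr fun z => ?_
    rw [ih, ← ENNReal.tsum_mul_left]
    refine tsum_congr fun y => ?_
    have hy : birkhoff φ (n + 1) y.1 = birkhoff φ n y.1 + φ z := by
      rw [birkhoff, Finset.sum_range_succ, y.2, birkhoff]
    change _ = ENNReal.ofReal (Real.exp (birkhoff φ (n + 1) y.1)) * f y.1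
    rw [hy, Real.exp_add, ENNReal.ofReal_mul (Real.exp_pos _).le]
    ring

lemma transfer_iterate_comp_mul (n : ℕ) (h f : Space A → ℝ≥0∞) (x : Space A) :
    (transfer φ)^[n] (fun y => h (shift^[n] y) * f y) x = h x * (transfer φ)^[n] f x := by
  simp only [transfer_iterate_eq_tsum_fiber, ← ENNReal.tsum_mul_left]
  refine tsum_congr fun y => ?_
  rw [y.2]
  ring

lemma transfer_iterate_mono (n : ℕ) {f g : Space A → ℝ≥0∞} (h : f ≤ g) :
    (transfer φ)^[n] f ≤ (transfer φ)^[n] g := by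
  intro x
  simp only [transfer_iterate_eq_tsum_fiber]
  exact ENNReal.tsum_le_tsum fun y => mul_le_mul_right (h y) _

lemma measurable_transfer (hφ : Measurable φ) {f : Space A → ℝ≥0∞} (hf : Measurable f) :
    Measurable (transfer φ f) := by
  refine Measurable.tsum fun a => Measurable.indicator ?_ (measurableSet_admits a)
  exact ((Real.measurable_exp.comp (hφ.comp (measurable_prep a))).ennreal_ofReal).mul
    (hf.comp (measurable_prep a))

lemma measurable_transfer_iterate (hφ : Measurable φ) (n : ℕ) {f : Space A → ℝ≥0∞}
    (hf : Measurable f) : Measurable ((transfer φ)^[n] f) := by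
  induction n with
  | zero => exact hf
  | succ n ih =>
    rw [Function.iterate_succ_apply']
    exact measurable_transfer hφ ih

lemma Conformal.lintegral_eq (hφ : Measurable φ) (hl : 0 < l) (hconf : Conformal A φ l ν)
    {f : Space A → ℝ≥0∞} (hf : Measurable f) :
    ∫⁻ x, f x ∂ν = ENNReal.ofReal l⁻¹ * ∫⁻ x, transfer φ f x ∂ν := by
  have hexp : Measurable fun x => ENNReal.ofReal (Real.exp (φ x)) :=
    (Real.measurable_exp.comp hφ).ennreal_ofReal
  have hν : ν = (circ A ν).withDensity
      fun x => ENNReal.ofReal l⁻¹ * ENNReal.ofReal (Real.exp (φ x)) := by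
    ext E hE
    rw [withDensity_apply _ hE, hconf E hE]
    simp_rw [ENNReal.ofReal_mul (inv_pos.2 hl).le]
  have hef : Measurable fun x => ENNReal.ofReal (Real.exp (φ x)) * f x := hexp.mul hf
  calc ∫⁻ x, f x ∂ν
      = ∫⁻ x, ENNReal.ofReal l⁻¹ * (ENNReal.ofReal (Real.exp (φ x)) * f x) ∂(circ A ν) := by
        conv_lhs => rw [hν]
        rw [lintegral_withDensity_eq_lintegral_mul _ (hexp.const_mul _) hf]
        simp only [Pi.mul_apply, mul_assoc]
    _ = ENNReal.ofReal l⁻¹ * ∫⁻ x, transfer φ f x ∂ν := by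
        rw [lintegral_const_mul _ hef]
        congr 1
        rw [circ, lintegral_sum_measure]
        refine Eq.trans ?_ (lintegral_tsum fun a => ((hef.comp (measurable_prep a)).indicator
          (measurableSet_admits a)).aemeasurable).symm
        refine tsum_congr fun a => ?_
        rw [lintegral_map hef (measurable_prep a), lintegral_indicator (measurableSet_admits a)]
        rfl

lemma Conformal.lintegral_eq_iterate (hφ : Measurable φ) (hl : 0 < l) (hconf : Conformal A φ l ν)
    (n : ℕ) {f : Space A → ℝ≥0∞} (hf : Measurable f) :
    ∫⁻ x, f x ∂ν = ENNReal.ofReal l⁻¹ ^ n * ∫⁻ x, (transfer φ)^[n] f x ∂ν := by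
  induction n with
  | zero => simp
  | succ n ih =>
    rw [ih, hconf.lintegral_eq hφ hl (measurable_transfer_iterate hφ n hf), pow_succ, mul_assoc,
      ← Function.iterate_succ_apply' (transfer φ)]

lemma Conformal.setLIntegral_preimage (hφ : Measurable φ) (hl : 0 < l)
    (hconf : Conformal A φ l ν) (n : ℕ) {f : Space A → ℝ≥0∞} (hf : Measurable f)
    {B : Set (Space A)} (hB : MeasurableSet B) :
    ∫⁻ x in shift^[n] ⁻¹' B, f x ∂ν
      = ENNReal.ofReal l⁻¹ ^ n * ∫⁻ x in B, (transfer φ)^[n] f x ∂ν := by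
  have hσB : MeasurableSet (shift^[n] ⁻¹' B) := measurable_shift.iterate n hB
  have hind : (shift^[n] ⁻¹' B).indicator f
      = fun y => B.indicator (fun _ => (1 : ℝ≥0∞)) (shift^[n] y) * f y := by
    funext y
    by_cases hy : shift^[n] y ∈ B <;> simp [Set.indicator, hy]
  rw [← lintegral_indicator hσB, hconf.lintegral_eq_iterate hφ hl n (hf.indicator hσB),
    ← lintegral_indicator hB, hind]
  congr 1
  refine lintegral_congr fun x => ?_
  rw [transfer_iterate_comp_mul]
  by_cases hx : x ∈ B <;> simp [Set.indicator, hx]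

lemma Conformal.ae_transfer_iterate_one_ne_top (hφ : Measurable φ) (hl : 0 < l)
    (hconf : Conformal A φ l ν) (hfin : ∀ n a : ℕ, ν {x : Space A | x.1 n = a} ≠ ⊤) (n : ℕ) :
    ∀ᵐ x ∂ν, (transfer φ)^[n] 1 x ≠ ⊤ := by
  have hmeas := measurable_transfer_iterate hφ n (f := 1) measurable_one
  have hcover : (⋃ a : ℕ, {x : Space A | x.1 0 = a}) = Set.univ :=
    Set.eq_univ_of_forall fun x => Set.mem_iUnion.2 ⟨x.1 0, rfl⟩
  rw [← Measure.restrict_univ (μ := ν), ← hcover, ae_restrict_iUnion_iff]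
  intro a
  have ha : MeasurableSet {x : Space A | x.1 0 = a} :=
    measurable_coord 0 (measurableSet_singleton a)
  have hpre : shift^[n] ⁻¹' {x : Space A | x.1 0 = a} = {x | x.1 n = a} := by
    ext x
    simp [shift_iterate_apply]
  have h := hconf.setLIntegral_preimage hφ hl n (f := 1) measurable_one ha
  rw [hpre] at h
  simp only [Pi.one_apply, setLIntegral_one] at h
  have hne : ∫⁻ x in {x : Space A | x.1 0 = a}, (transfer φ)^[n] 1 x ∂ν ≠ ⊤ := by
    intro htop
    refine hfin n a ?_
    rw [h, htop, ENNReal.mul_top]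
    exact pow_ne_zero _ (ENNReal.ofReal_pos.2 (inv_pos.2 hl)).ne'
  exact (ae_lt_top hmeas hne).mono fun x hx => hx.ne

lemma dlrDen_eq_toReal (n : ℕ) (x : Space A) :
    dlrDen A φ n x = ((transfer φ)^[n] 1 (shift^[n] x)).toReal := by
  rw [transfer_iterate_eq_tsum_fiber, ENNReal.tsum_toReal_eq fun y => by simp, dlrDen]
  refine tsum_congr fun y => ?_
  simp [(Real.exp_pos _).le]

lemma dlrNum_eq_toReal (w : List ℕ) (x : Space A) :
    dlrNum A φ w x =
      ((transfer φ)^[w.length] ((cyl A w).indicator 1) (shift^[w.length] x)).toReal := by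
  rw [transfer_iterate_eq_tsum_fiber, dlrNum]
  split_ifs with h
  · obtain ⟨h₁, h₂⟩ := eq_concatSeq_iff.1
      (rfl : (⟨_, h⟩ : Space A).1 = concatSeq w (shift^[w.length] x).1)
    rw [tsum_eq_single ⟨⟨_, h⟩, h₁⟩]
    · simp [Set.indicator_of_mem h₂, (Real.exp_pos _).le]
    · intro y hy
      rw [Set.indicator_of_notMem, mul_zero]
      exact fun hyw => hy (Subtype.ext (Subtype.ext (eq_concatSeq_iff.2 ⟨y.2, hyw⟩)))
  · rw [ENNReal.tsum_eq_zero.2, ENNReal.toReal_zero]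
    intro y
    rw [Set.indicator_of_notMem, mul_zero]
    intro hyw
    exact h (eq_concatSeq_iff.2 ⟨y.2, hyw⟩ ▸ y.1.2)

lemma shiftSigma_le (n : ℕ) : shiftSigma A n ≤ Subtype.instMeasurableSpace :=
  (measurable_shift.iterate n).comap_le

lemma compatible_shiftSigma (hfin : ∀ n a : ℕ, ν {x : Space A | x.1 n = a} ≠ ⊤) (n : ℕ) :
    Compatible A ν (shiftSigma A n) := by
  refine ⟨fun a => {x | x.1 n = a}, fun a => ⟨{x | x.1 0 = a},
    measurable_coord 0 (measurableSet_singleton a), ?_⟩, hfin n,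
    Set.eq_univ_of_forall fun x => Set.mem_iUnion.2 ⟨x.1 n, rfl⟩⟩
  ext x
  simp [shift_iterate_apply]

lemma Compatible.sigmaFinite_trim {m : MeasurableSpace (Space A)}
    (h : Compatible A ν m) (hm : m ≤ Subtype.instMeasurableSpace) :
    SigmaFinite (ν.trim hm) := by
  obtain ⟨s, hs, hfin, hcover⟩ := h
  exact ⟨⟨⟨s, fun _ => trivial, fun k => by
    rw [trim_measurableSet_eq hm (hs k)]
    exact (hfin k).lt_top, hcover⟩⟩⟩

/-- The conditional probability of a set `C` given the tail `shift^[n] x = z`. -/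
noncomputable def tailProb (φ : Space A → ℝ) (n : ℕ) (C : Set (Space A)) (z : Space A) : ℝ≥0∞ :=
  (transfer φ)^[n] (C.indicator 1) z / (transfer φ)^[n] 1 z

lemma transfer_iterate_indicator_le (n : ℕ) (C : Set (Space A)) (z : Space A) :
    (transfer φ)^[n] (C.indicator 1) z ≤ (transfer φ)^[n] 1 z :=
  transfer_iterate_mono n (Set.indicator_le_self' fun _ _ => zero_le_one) z

lemma tailProb_le_one (n : ℕ) (C : Set (Space A)) (z : Space A) : tailProb φ n C z ≤ 1 :=
  ENNReal.div_le_of_le_mul (by simpa using transfer_iterate_indicator_le n C z)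

lemma measurable_tailProb (hφ : Measurable φ) (n : ℕ) {C : Set (Space A)} (hC : MeasurableSet C) :
    Measurable (tailProb φ n C) :=
  (measurable_transfer_iterate hφ n (measurable_one.indicator hC)).div
    (measurable_transfer_iterate hφ n measurable_one)

lemma dlr_ratio_eq_toReal_tailProb (w : List ℕ) (x : Space A) :
    dlrNum A φ w x / dlrDen A φ w.length x
      = (tailProb φ w.length (cyl A w) (shift^[w.length] x)).toReal := by
  rw [dlrNum_eq_toReal, dlrDen_eq_toReal, tailProb, ENNReal.toReal_div]

lemma Conformal.setLIntegral_tailProb (hφ : Measurable φ) (hl : 0 < l)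
    (hconf : Conformal A φ l ν) (hfin : ∀ n a : ℕ, ν {x : Space A | x.1 n = a} ≠ ⊤) (n : ℕ)
    {C B : Set (Space A)} (hC : MeasurableSet C) (hB : MeasurableSet B) :
    ∫⁻ x in shift^[n] ⁻¹' B, tailProb φ n C (shift^[n] x) ∂ν = ν (C ∩ shift^[n] ⁻¹' B) := by
  have hleft := hconf.setLIntegral_preimage hφ hl n
    ((measurable_tailProb hφ n hC).comp (measurable_shift.iterate n)) hB
  have hright := hconf.setLIntegral_preimage hφ hl n (measurable_one.indicator hC) hB
  rw [lintegral_indicator_one hC, Measure.restrict_apply hC] at hright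
  rw [hright]
  refine hleft.trans ?_
  congr 1
  refine lintegral_congr_ae (ae_restrict_of_ae ?_)
  filter_upwards [hconf.ae_transfer_iterate_one_ne_top hφ hl hfin n] with z hz
  have h := transfer_iterate_comp_mul (φ := φ) n (tailProb φ n C) 1 z
  simp only [Pi.one_apply, mul_one] at h
  refine h.trans ?_
  refine ENNReal.div_mul_cancel' (fun h0 => ?_) fun h => (hz h).elim
  exact le_antisymm (h0 ▸ transfer_iterate_indicator_le n C z) zero_le

lemma Conformal.condExp_indicator_eq (hφ : Measurable φ) (hl : 0 < l)
    (hconf : Conformal A φ l ν) (hfin : ∀ n a : ℕ, ν {x : Space A | x.1 n = a} ≠ ⊤) (n : ℕ)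
    {C : Set (Space A)} (hC : MeasurableSet C) (hνC : ν C ≠ ⊤) :
    ν[C.indicator (fun _ => (1 : ℝ))|shiftSigma A n]
      =ᵐ[ν] fun x => (tailProb φ n C (shift^[n] x)).toReal := by
  have hm := shiftSigma_le (A := A) n
  have := (compatible_shiftSigma hfin n).sigmaFinite_trim hm
  have hσ : Measurable (shift^[n] : Space A → Space A) := measurable_shift.iterate n
  have hP := measurable_tailProb hφ n hC
  have hPσ : Measurable fun x => tailProb φ n C (shift^[n] x) := hP.comp hσ
  refine (ae_eq_condExp_of_forall_setIntegral_eq hm ((integrable_indicator_iff hC).2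
    (integrableOn_const hνC)) ?_ ?_ ?_).symm
  · intro s _ hνs
    refine IntegrableOn.of_bound hνs
      hPσ.ennreal_toReal.aestronglyMeasurable 1 (ae_of_all _ fun x => ?_)
    rw [Real.norm_of_nonneg ENNReal.toReal_nonneg]
    exact ENNReal.toReal_mono ENNReal.one_ne_top (tailProb_le_one n C _)
  · rintro s ⟨B, hB, rfl⟩ -
    rw [integral_toReal hPσ.aemeasurable
        (ae_of_all _ fun x => (tailProb_le_one n C _).trans_lt ENNReal.one_lt_top),
      setIntegral_indicator hC, setIntegral_const, smul_eq_mul, mul_one, measureReal_def,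
      Set.inter_comm]
    exact congrArg ENNReal.toReal (hconf.setLIntegral_tailProb hφ hl hfin n hC hB)
  · exact (hP.ennreal_toReal.comp (comap_measurable _)).stronglyMeasurable.aestronglyMeasurable

end Transfer

theorem statement5 (A : ℕ → ℕ → Bool) (hA : NoDegenerate A)
    (φ : Space A → ℝ) (hφ : Measurable φ)
    (ν : Measure (Space A)) (hsf : SigmaFinite ν)
    (hfin : ∀ n a : ℕ, ν {x : Space A | x.1 n = a} ≠ ⊤)
    (l : ℝ) (hl : 0 < l) (hns : NonSingular A ν) (hconf : Conformal A φ l ν) :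
    IsDLR A φ ν := by
  rintro _ hn
  refine ⟨compatible_shiftSigma hfin _, ?_⟩
  rintro w rfl
  have hcyl : ν (cyl A w) ≠ ⊤ :=
    measure_ne_top_of_subset (fun x hx => hx ⟨0, hn⟩) (hfin 0 (w.get ⟨0, hn⟩))
  simp only [dlr_ratio_eq_toReal_tailProb]
  exact hconf.condExp_indicator_eq hφ hl hfin _ (measurableSet_cyl w) hcyl

end CMS
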